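/- Let D be an associative unital algebra over a field k and let T : D ⊗ D → D ⊗ D be an R-matrix for D. Then μ ∘ T : D ⊗ D → D is an associative multiplication on the vector space D with the same unit 1. -/

import Mathlib

open TensorProduct

noncomputable section

/-- `T₁₂ = T ⊗ id` on `(D ⊗ D) ⊗ D`. -/
def tensor12 (k : Type*) [Field k] (D : Type*) [AddCommGroup D] [Module k D]
    (T : D ⊗[k] D →ₗ[k] D ⊗[k] D) :
    (D ⊗[k] D) ⊗[k] D →ₗ[k] (D ⊗[k] D) ⊗[k] D :=
  T.rTensor D

/-- `T₂₃ = id ⊗ T` on `(D ⊗ D) ⊗ D`. -/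
def tensor23 (k : Type*) [Field k] (D : Type*) [AddCommGroup D] [Module k D]
    (T : D ⊗[k] D →ₗ[k] D ⊗[k] D) :
    (D ⊗[k] D) ⊗[k] D →ₗ[k] (D ⊗[k] D) ⊗[k] D :=
  (TensorProduct.assoc k D D D).symm.toLinearMap ∘ₗ T.lTensor D ∘ₗ
    (TensorProduct.assoc k D D D).toLinearMap

/-- the flip `id ⊗ τ` of the last two tensor factors of `(D ⊗ D) ⊗ D`. -/
def flip23 (k : Type*) [Field k] (D : Type*) [AddCommGroup D] [Module k D] :
    (D ⊗[k] D) ⊗[k] D →ₗ[k] (D ⊗[k] D) ⊗[k] D :=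
  (TensorProduct.assoc k D D D).symm.toLinearMap ∘ₗ
    ((TensorProduct.comm k D D).toLinearMap.lTensor D) ∘ₗ
    (TensorProduct.assoc k D D D).toLinearMap

/-- `T₁₃ = (id ⊗ τ) ∘ (T ⊗ id) ∘ (id ⊗ τ)` on `(D ⊗ D) ⊗ D`. -/
def tensor13 (k : Type*) [Field k] (D : Type*) [AddCommGroup D] [Module k D]
    (T : D ⊗[k] D →ₗ[k] D ⊗[k] D) :
    (D ⊗[k] D) ⊗[k] D →ₗ[k] (D ⊗[k] D) ⊗[k] D :=
  flip23 k D ∘ₗ tensor12 k D T ∘ₗ flip23 k D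

/-- `μ₁₂ = μ ⊗ id` on `(D ⊗ D) ⊗ D`, for a multiplication `m`. -/
def mul12 (k : Type*) [Field k] (D : Type*) [AddCommGroup D] [Module k D]
    (m : D ⊗[k] D →ₗ[k] D) :
    (D ⊗[k] D) ⊗[k] D →ₗ[k] D ⊗[k] D :=
  m.rTensor D

/-- `μ₂₃ = id ⊗ μ` on `(D ⊗ D) ⊗ D`, for a multiplication `m`. -/
def mul23 (k : Type*) [Field k] (D : Type*) [AddCommGroup D] [Module k D]
    (m : D ⊗[k] D →ₗ[k] D) :
    (D ⊗[k] D) ⊗[k] D →ₗ[k] D ⊗[k] D :=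
  m.lTensor D ∘ₗ (TensorProduct.assoc k D D D).toLinearMap

/-- A twistor for a (possibly deformed) multiplication `m` with unit `e`:
`T(e ⊗ d) = e ⊗ d`, `T(d ⊗ e) = d ⊗ e`,
`μ₂₃ ∘ T₁₃ ∘ T₁₂ = T ∘ μ₂₃`, `μ₁₂ ∘ T₁₃ ∘ T₂₃ = T ∘ μ₁₂`, `T₁₂ ∘ T₂₃ = T₂₃ ∘ T₁₂`. -/
structure IsTwistor (k : Type*) [Field k] (D : Type*) [AddCommGroup D] [Module k D]
/-- An R-matrix (Borcherds) for a multiplication `m` with unit `e`: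
`T(e ⊗ d) = e ⊗ d`, `T(d ⊗ e) = d ⊗ e`,
`μ₂₃ ∘ T₁₂ ∘ T₁₃ = T ∘ μ₂₃`, `μ₁₂ ∘ T₂₃ ∘ T₁₃ = T ∘ μ₁₂`,
`T₁₂ ∘ T₁₃ ∘ T₂₃ = T₂₃ ∘ T₁₃ ∘ T₁₂`. -/
structure IsRMatrix (k : Type*) [Field k] (D : Type*) [AddCommGroup D] [Module k D]
    (m : D ⊗[k] D →ₗ[k] D) (e : D) (T : D ⊗[k] D →ₗ[k] D ⊗[k] D) : Prop where
  one_left : ∀ d : D, T (e ⊗ₜ[k] d) = e ⊗ₜ[k] d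
  one_right : ∀ d : D, T (d ⊗ₜ[k] e) = d ⊗ₜ[k] e
  mul_right : mul23 k D m ∘ₗ tensor12 k D T ∘ₗ tensor13 k D T = T ∘ₗ mul23 k D m
  mul_left : mul12 k D m ∘ₗ tensor23 k D T ∘ₗ tensor13 k D T = T ∘ₗ mul12 k D m
  qybe : tensor12 k D T ∘ₗ tensor13 k D T ∘ₗ tensor23 k D T =
    tensor23 k D T ∘ₗ tensor13 k D T ∘ₗ tensor12 k D T

/-- Theorem 3.1 (Borcherds): if `T` is an R-matrix for an algebra `D`, then `μ ∘ T` is an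
associative multiplication on `D` with the same unit `1`. -/
theorem rmatrix_gives_algebra (k : Type*) [Field k] (D : Type*) [Ring D] [Algebra k D]
    (T : D ⊗[k] D →ₗ[k] D ⊗[k] D)
    (hT : IsRMatrix k D (LinearMap.mul' k D) 1 T) :
    (∀ d : D, (LinearMap.mul' k D ∘ₗ T) ((1 : D) ⊗ₜ[k] d) = d) ∧
    (∀ d : D, (LinearMap.mul' k D ∘ₗ T) (d ⊗ₜ[k] (1 : D)) = d) ∧
    (LinearMap.mul' k D ∘ₗ T) ∘ₗ (LinearMap.mul' k D ∘ₗ T).rTensor D =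
      ((LinearMap.mul' k D ∘ₗ T) ∘ₗ (LinearMap.mul' k D ∘ₗ T).lTensor D) ∘ₗ
        (TensorProduct.assoc k D D D).toLinearMap := by
  have assoc' : ∀ z : (D ⊗[k] D) ⊗[k] D,
      LinearMap.mul' k D (mul12 k D (LinearMap.mul' k D) z) =
        LinearMap.mul' k D (mul23 k D (LinearMap.mul' k D) z) := by
    intro z
    have h : LinearMap.mul' k D ∘ₗ mul12 k D (LinearMap.mul' k D) =
        LinearMap.mul' k D ∘ₗ mul23 k D (LinearMap.mul' k D) := by
      ext a b c
      simp [mul12, mul23, mul_assoc]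
    exact LinearMap.congr_fun h z
  refine ⟨fun d => ?_, fun d => ?_, ?_⟩
  · simp [hT.one_left]
  · simp [hT.one_right]
  · refine LinearMap.ext fun x => ?_
    have e1 : (LinearMap.mul' k D ∘ₗ T).rTensor D x =
        mul12 k D (LinearMap.mul' k D) (tensor12 k D T x) := by
      simp only [mul12, tensor12, LinearMap.rTensor_comp, LinearMap.comp_apply]
    have e2 : (LinearMap.mul' k D ∘ₗ T).lTensor D (TensorProduct.assoc k D D D x) =
        mul23 k D (LinearMap.mul' k D) (tensor23 k D T x) := by
      simp only [mul23, tensor23, LinearMap.lTensor_comp, LinearMap.comp_apply,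
        LinearEquiv.coe_coe, LinearEquiv.apply_symm_apply]
    have h1 := LinearMap.congr_fun hT.mul_left (tensor12 k D T x)
    have h2 := LinearMap.congr_fun hT.mul_right (tensor23 k D T x)
    have h3 := LinearMap.congr_fun hT.qybe x
    simp only [LinearMap.comp_apply] at h1 h2 h3
    simp only [LinearMap.comp_apply, LinearEquiv.coe_coe]
    rw [e1, e2, ← h1, ← h2, h3, assoc']
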